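/- Let B be a real separable Banach space with dual B*, and let X be a random element taking values in B with probability distribution μ satisfying ∫_B ‖x‖² μ(dx) < ∞. Then there exists a bounded linear operator S : B* → B such that g(S f) = ∫_B f(x) g(x) μ(dx) for all f, g ∈ B*. -/

import Mathlib

open MeasureTheory

lemma ContinuousLinearMap.norm_apply_smul_self_le
    {B : Type*} [SeminormedAddCommGroup B] [NormedSpace ℝ B] (f : B →L[ℝ] ℝ) (x : B) :
    ‖f x • x‖ ≤ ‖f‖ * ‖x‖ ^ 2 := by
  calc ‖f x • x‖ = ‖f x‖ * ‖x‖ := norm_smul _ _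
    _ ≤ ‖f‖ * ‖x‖ * ‖x‖ := by gcongr; exact f.le_opNorm x
    _ = ‖f‖ * ‖x‖ ^ 2 := by ring

/-- If `‖x‖ ^ 2` is integrable, then so is `x ↦ f x • x` for every bounded functional `f`. -/
lemma ContinuousLinearMap.integrable_apply_smul_self
    {B : Type*} [NormedAddCommGroup B] [NormedSpace ℝ B] [SecondCountableTopology B]
    [MeasurableSpace B] [BorelSpace B] {μ : Measure B}
    (hint : Integrable (fun x => ‖x‖ ^ 2) μ) (f : B →L[ℝ] ℝ) :
    Integrable (fun x => f x • x) μ := by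
  refine (hint.const_mul ‖f‖).mono' (by fun_prop) (ae_of_all _ f.norm_apply_smul_self_le)

/-- Existence of the covariance operator of a Banach-space-valued random element:
if `X` takes values in a real separable Banach space `B` with distribution `μ`
satisfying `∫ ‖x‖² dμ < ∞`, then there is a bounded linear operator `S : B* → B`
with `g (S f) = ∫ f(x) g(x) dμ` for all `f, g ∈ B*`. -/
theorem covariance_operator_exists
    {B : Type*} [NormedAddCommGroup B] [NormedSpace ℝ B] [CompleteSpace B]
    [TopologicalSpace.SeparableSpace B] [MeasurableSpace B] [BorelSpace B]
    {Ω : Type*} [MeasurableSpace Ω] (P : Measure Ω) [IsProbabilityMeasure P]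
    (X : Ω → B) (hX : Measurable X)
    (μ : Measure B) (hμ : μ = P.map X)
    (hint : Integrable (fun x => ‖x‖ ^ 2) μ) :
    ∃ S : (B →L[ℝ] ℝ) →L[ℝ] B,
      ∀ f g : B →L[ℝ] ℝ, g (S f) = ∫ x, f x * g x ∂μ := by
  have : SecondCountableTopology B := UniformSpace.secondCountable_of_separable B
  have hi := ContinuousLinearMap.integrable_apply_smul_self hint
  refine ⟨LinearMap.mkContinuous
    { toFun := fun f => ∫ x, f x • x ∂μ
      map_add' := fun f g => by
        simp only [add_apply, add_smul]
        exact integral_add (hi f) (hi g)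
      map_smul' := fun c f => by
        simp only [smul_apply, smul_assoc, RingHom.id_apply]
        exact integral_smul c _ }
    (∫ x, ‖x‖ ^ 2 ∂μ) fun f => ?_, fun f g => ?_⟩
  · change ‖∫ x, f x • x ∂μ‖ ≤ _
    rw [mul_comm, ← integral_const_mul]
    refine norm_integral_le_of_norm_le (hint.const_mul ‖f‖) (ae_of_all _ f.norm_apply_smul_self_le)
  · change g (∫ x, f x • x ∂μ) = _
    rw [← g.integral_comp_comm (hi f)]
    simp
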